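/- Let Z be a real n×m matrix with nonnegative entries whose rows each sum to 1 (Z·1_m = 1_n), and suppose every column sum Σ_jj = Σ_{i=1}^n Z_{ij} is positive. Let Σ be the m×m diagonal matrix with these column sums on the diagonal, and set S = ZΣ⁻¹Zᵀ. Then every row of S sums to 1, i.e., S·1_n = 1_n. -/

import Mathlib

open Matrix

/-- If `Z` is entrywise nonnegative with row sums 1 and positive column sums,
and `Σ` is the diagonal matrix of column sums, then every row of
`S = ZΣ⁻¹Zᵀ` sums to 1. -/
theorem stmt_8 (n m : ℕ) (Z : Matrix (Fin n) (Fin m) ℝ)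
    (hnn : ∀ i j, 0 ≤ Z i j) (hrow : ∀ i, ∑ j, Z i j = 1)
    (hcol : ∀ j, 0 < ∑ i, Z i j) :
    ∀ i, ∑ i', (Z * Matrix.diagonal (fun j => (∑ i'', Z i'' j)⁻¹) * Zᵀ) i i' = 1 := by
  intro i
  simp only [Matrix.mul_apply (N := Zᵀ), Matrix.mul_diagonal, Matrix.transpose_apply]
  rw [Finset.sum_comm, ← hrow i]
  refine Finset.sum_congr rfl fun j _ => ?_
  rw [← Finset.mul_sum, inv_mul_cancel_right₀ (hcol j).ne']
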